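/- arXiv:2002.09551 — 3 statements merged into one kernel-verified Lean document; each statement's English description precedes it below -/
import Mathlib

section
/- Let M be a commutative monoid, let x, y ∈ M, and let n be an odd positive integer. Then the multiset {x^(n-k) * y^k : k = 0, 1, ..., n} is equal to the multiset sum, over k = 1, ..., (n+1)/2, of the two-element multisets {(x*y)^((n-2k+1)/2) * x^(2k-1), (x*y)^((n-2k+1)/2) * y^(2k-1)}. -/
/-- A sum over `0, ..., 2N - 1` regrouped into pairs symmetric about the middle. -/
theorem Finset.sum_range_two_mul_eq_sum_Icc_pairs {A : Type*} [AddCommMonoid A] (f : ℕ → A)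
    (N : ℕ) :
    ∑ i ∈ Finset.range (2 * N), f i = ∑ k ∈ Finset.Icc 1 N, (f (N - k) + f (N + k - 1)) := by
  have h : Finset.Icc 1 N = Finset.Ico (0 + 1) (N + 1) := by ext; simp
  rw [two_mul, Finset.sum_range_add, ← Finset.sum_range_reflect, ← Finset.sum_add_distrib, h,
    ← Finset.sum_Ico_add' _ 0 N 1, Finset.range_eq_Ico]
  refine Finset.sum_congr rfl fun k _ => ?_
  congr 2
  omega

/-- Decomposition of the multiset `{x^(n-k) * y^k : k = 0, ..., n}` for odd `n`
into pairs indexed by `k = 1, ..., (n+1)/2`. -/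
theorem sym_multiset_decomp_odd (M : Type*) [CommMonoid M] (x y : M) (n : ℕ)
    (hn : Odd n) (hpos : 0 < n) :
    (Multiset.range (n + 1)).map (fun k => x ^ (n - k) * y ^ k) =
      ∑ k ∈ Finset.Icc 1 ((n + 1) / 2),
        ({(x * y) ^ ((n + 1 - 2 * k) / 2) * x ^ (2 * k - 1),
          (x * y) ^ ((n + 1 - 2 * k) / 2) * y ^ (2 * k - 1)} : Multiset M) := by
  obtain ⟨m, rfl⟩ := hn
  have hsum : (Multiset.range (2 * m + 1 + 1)).map (fun k => x ^ (2 * m + 1 - k) * y ^ k) =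
      ∑ k ∈ Finset.range (2 * (m + 1)), ({x ^ (2 * m + 1 - k) * y ^ k} : Multiset M) := by
    rw [← Multiset.sum_map_singleton (Multiset.map _ _), Multiset.map_map]
    rfl
  rw [hsum, Finset.sum_range_two_mul_eq_sum_Icc_pairs, show (2 * m + 1 + 1) / 2 = m + 1 by omega]
  refine Finset.sum_congr rfl fun k hk => ?_
  obtain ⟨hk₁, hk₂⟩ := Finset.mem_Icc.mp hk
  obtain ⟨j, hj⟩ := Nat.exists_eq_add_of_le hk₂
  rw [Multiset.singleton_add, show (2 * m + 1 + 1 - 2 * k) / 2 = j by omega,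
    show 2 * m + 1 - (m + 1 - k) = j + (2 * k - 1) by omega, show m + 1 - k = j by omega,
    show 2 * m + 1 - (m + 1 + k - 1) = j by omega,
    show m + 1 + k - 1 = j + (2 * k - 1) by omega, pow_add, pow_add, mul_pow,
    mul_right_comm, mul_assoc (x ^ j) (y ^ j) (y ^ (2 * k - 1))]
  rfl
end

section
/- Let G be a commutative group, let χ₁, χ₂ : G → ℂˣ be group homomorphisms, let n be a natural number, and let T be a function from {0, 1, ..., n} to G. Then, with all sums taken in ℂ over the symmetric group on {0, 1, ..., n}: ∑_{s} ∏_{j=0}^{n} χ₁(T(s(j)))^(n-j) · χ₂(T(s(j)))^j = (1/2) · ∑_{w} [ χ₁(∏_{j=0}^{n} T(w(j))^(n-j)) · χ₂(∏_{j=0}^{n} T(w(j))^j) + χ₂(∏_{j=0}^{n} T(w(j))^(n-j)) · χ₁(∏_{j=0}^{n} T(w(j))^j) ]. -/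
open scoped BigOperators

/-- Reversing the order of `0, …, n` exchanges the exponents `j` and `n - j` in a sum over
all permutations. -/
theorem sum_perm_prod_rev {R : Type*} [CommSemiring R] (n : ℕ) (a b : Fin (n + 1) → R) :
    ∑ w : Equiv.Perm (Fin (n + 1)), ∏ j : Fin (n + 1),
        (b (w j) ^ (n - (j : ℕ)) * a (w j) ^ (j : ℕ)) =
      ∑ w : Equiv.Perm (Fin (n + 1)), ∏ j : Fin (n + 1),
        (a (w j) ^ (n - (j : ℕ)) * b (w j) ^ (j : ℕ)) := by
  refine Fintype.sum_equiv (Equiv.mulRight Fin.revPerm) _ _ fun w => ?_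
  refine Fintype.prod_equiv Fin.revPerm _ _ fun j => ?_
  have hj : n - (n - (j : ℕ)) = j := Nat.sub_sub_self (Nat.le_of_lt_succ j.isLt)
  simp [Fin.val_rev, hj, mul_comm]

/-- The stable transfer factor identity for principal series on the diagonal torus. -/
theorem transfer_factor_identity (G : Type*) [CommGroup G]
    (χ₁ χ₂ : G →* ℂˣ) (n : ℕ) (T : Fin (n + 1) → G) :
    ∑ s : Equiv.Perm (Fin (n + 1)), ∏ j : Fin (n + 1),
        ((χ₁ (T (s j)) : ℂ) ^ (n - (j : ℕ)) * (χ₂ (T (s j)) : ℂ) ^ (j : ℕ)) =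
      (1 / 2 : ℂ) * ∑ w : Equiv.Perm (Fin (n + 1)),
        ((χ₁ (∏ j : Fin (n + 1), T (w j) ^ (n - (j : ℕ))) : ℂ) *
            (χ₂ (∏ j : Fin (n + 1), T (w j) ^ (j : ℕ)) : ℂ) +
          (χ₂ (∏ j : Fin (n + 1), T (w j) ^ (n - (j : ℕ))) : ℂ) *
            (χ₁ (∏ j : Fin (n + 1), T (w j) ^ (j : ℕ)) : ℂ)) := by
  simp only [map_prod, map_pow, Units.coe_prod, Units.val_pow_eq_pow_val,
    ← Finset.prod_mul_distrib, Finset.sum_add_distrib]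
  rw [sum_perm_prod_rev n (fun i => (χ₁ (T i) : ℂ)) (fun i => (χ₂ (T i) : ℂ))]
  ring
end

section
/- Let p be a prime, let u and v be units of the ring ℤ_p of p-adic integers, and let n be a positive integer coprime to p(p−1). Then ‖u^n − v^n‖ = ‖u − v‖, where ‖·‖ is the standard p-adic norm. -/
/-- In `ZMod p`, the quotient `(a ^ n - b ^ n) / (a - b)`, written as a geometric sum, does not
vanish at units `a, b` when `n` is coprime to `p * (p - 1)`. -/
theorem ZMod.geom_sum₂_ne_zero {p : ℕ} [Fact p.Prime] (a b : (ZMod p)ˣ) {n : ℕ}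
    (hcop : n.Coprime (p * (p - 1))) :
    ∑ i ∈ Finset.range n, (a : ZMod p) ^ i * (b : ZMod p) ^ (n - 1 - i) ≠ 0 := by
  obtain ⟨hp, hp1⟩ := Nat.coprime_mul_iff_right.mp hcop
  intro h
  have hab : a = b := by
    have hcard : (Nat.card (ZMod p)ˣ).Coprime n := by
      rw [Nat.card_eq_fintype_card, ZMod.card_units]
      exact hp1.symm
    refine (powCoprime hcard).injective (Units.ext ?_)
    rw [powCoprime_apply, powCoprime_apply, Units.val_pow_eq_pow_val, Units.val_pow_eq_pow_val,
      ← sub_eq_zero, ← geom_sum₂_mul, h, zero_mul]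
  subst hab
  rw [geom_sum₂_self, (a.isUnit.pow _).mul_left_eq_zero, ZMod.natCast_eq_zero_iff] at h
  exact (Fact.out : p.Prime).one_lt.ne' (Nat.Coprime.eq_one_of_dvd hp.symm h)

/-- A `p`-adic integer with nonzero reduction modulo `p` has norm one. -/
theorem PadicInt.norm_eq_one_of_toZMod_ne_zero {p : ℕ} [Fact p.Prime] {x : ℤ_[p]}
    (hx : PadicInt.toZMod x ≠ 0) : ‖x‖ = 1 := by
  rw [← PadicInt.isUnit_iff]
  by_contra h
  apply hx
  rwa [← RingHom.mem_ker, PadicInt.ker_toZMod, IsLocalRing.mem_maximalIdeal, mem_nonunits_iff]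

/-- For units `u, v` of `ℤ_p` and `n` positive coprime to `p(p-1)`,
`‖u^n - v^n‖ = ‖u - v‖`. -/
theorem norm_pow_sub_pow_eq (p : ℕ) [Fact p.Prime] (u v : ℤ_[p]ˣ)
    (n : ℕ) (hn : 0 < n) (hcop : Nat.Coprime n (p * (p - 1))) :
    ‖(u : ℤ_[p]) ^ n - (v : ℤ_[p]) ^ n‖ = ‖(u : ℤ_[p]) - (v : ℤ_[p])‖ := by
  rw [← geom_sum₂_mul, norm_mul, PadicInt.norm_eq_one_of_toZMod_ne_zero, one_mul]
  simpa using ZMod.geom_sum₂_ne_zero (Units.map (PadicInt.toZMod : ℤ_[p] →+* ZMod p) u)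
    (Units.map (PadicInt.toZMod : ℤ_[p] →+* ZMod p) v) hcop
end
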